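/- arXiv:2402.11731 — 4 statements merged into one kernel-verified Lean document; each statement's English description precedes it below -/
import Mathlib

section
/- Let x* ∈ Ē⁺ with Gp(x*) ≠ ∅, let I₀ ∈ Gp(x*) be an element of minimal length, and let I₀ ⊂ I₁ ⊂ … ⊂ I_L be the chain in which each I_ℓ (ℓ ≥ 1) is the dyadic parent of I_{ℓ−1} and L is the largest integer such that all I_ℓ (0 ≤ ℓ ≤ L) belong to Gp(x*). Then |I_L| ≥ (1/42) · dist(x*, I₀). -/
/-- An axis-parallel square, recorded by its lower-left corner `(x, y)` and side length `s`. -/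
structure Sq where
  x : ℝ
  y : ℝ
  s : ℝ

namespace Sq

/-- The (closed) square as a subset of ℝ². -/
def set (Q : Sq) : Set (ℝ × ℝ) :=
  Set.Icc Q.x (Q.x + Q.s) ×ˢ Set.Icc Q.y (Q.y + Q.s)

/-- `Q.dilate C` is the *open* axis-parallel square `CQ` with the same center as `Q` and
side length `C·δ_Q`. -/
def dilate (Q : Sq) (C : ℝ) : Set (ℝ × ℝ) :=
  Set.Ioo (Q.x + Q.s / 2 - C * Q.s / 2) (Q.x + Q.s / 2 + C * Q.s / 2) ×ˢ
    Set.Ioo (Q.y + Q.s / 2 - C * Q.s / 2) (Q.y + Q.s / 2 + C * Q.s / 2)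

/-- Dyadic squares: `Q⁰ = [-1,1]²` and all closed squares obtained from `Q⁰` by successive
bisection, i.e. `[i·2^{-k}, (i+1)·2^{-k}] × [j·2^{-k}, (j+1)·2^{-k}]` with
`i, j ∈ {-2^k, …, 2^k - 1}`. -/
def IsDyadic (Q : Sq) : Prop :=
  (Q.x = -1 ∧ Q.y = -1 ∧ Q.s = 2) ∨
    ∃ (k : ℕ) (i j : ℤ), -(2 ^ k : ℤ) ≤ i ∧ i < 2 ^ k ∧ -(2 ^ k : ℤ) ≤ j ∧ j < 2 ^ k ∧
      Q.x = (i : ℝ) * (2 : ℝ) ^ (-(k : ℤ)) ∧ Q.y = (j : ℝ) * (2 : ℝ) ^ (-(k : ℤ)) ∧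
      Q.s = (2 : ℝ) ^ (-(k : ℤ))

end Sq

/-- A closed interval, recorded by its left endpoint `a` and length `len`. -/
structure Iv where
  a : ℝ
  len : ℝ

namespace Iv

/-- The (closed) interval as a subset of ℝ. -/
def set (I : Iv) : Set ℝ := Set.Icc I.a (I.a + I.len)

/-- `I.dil C` is the *open* interval `CI` with the same center as `I` and length `C·|I|`. -/
def dil (I : Iv) (C : ℝ) : Set ℝ :=
  Set.Ioo (I.a + I.len / 2 - C * I.len / 2) (I.a + I.len / 2 + C * I.len / 2)

/-- Dyadic intervals: `I⁰ = [-1,1]` and all closed intervals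
`[i·2^{-k}, (i+1)·2^{-k}]` with `i ∈ {-2^k, …, 2^k - 1}`, obtained from `I⁰` by
successive bisection. -/
def IsDyadic (I : Iv) : Prop :=
  (I.a = -1 ∧ I.len = 2) ∨
    ∃ (k : ℕ) (i : ℤ), -(2 ^ k : ℤ) ≤ i ∧ i < 2 ^ k ∧
      I.a = (i : ℝ) * (2 : ℝ) ^ (-(k : ℤ)) ∧ I.len = (2 : ℝ) ^ (-(k : ℤ))

end Iv

/-- `E = Ē × {0} ⊂ ℝ²`. -/
def Eset (Ebar : Finset ℝ) : Set (ℝ × ℝ) := {z | z.1 ∈ Ebar ∧ z.2 = 0}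

/-- The hypotheses on the finite set `Ē ⊂ ℝ`: `#Ē ≥ 2` (so `N = #E ≥ 2`),
`max Ē = 2^{-11}` and `min Ē = -2^{-11}`. -/
def EbarHyp (Ebar : Finset ℝ) : Prop :=
  2 ≤ Ebar.card ∧ (2 : ℝ) ^ (-(11 : ℤ)) ∈ Ebar ∧ -(2 : ℝ) ^ (-(11 : ℤ)) ∈ Ebar ∧
    ∀ x ∈ Ebar, -(2 : ℝ) ^ (-(11 : ℤ)) ≤ x ∧ x ≤ (2 : ℝ) ^ (-(11 : ℤ))

/-- The Calderón–Zygmund collection `CZ`: the maximal dyadic squares `Q` such that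
`#(E ∩ 3Q) ≤ 1` (where `3Q` is the open concentric dilation). -/
def CZ (Ebar : Finset ℝ) (Q : Sq) : Prop :=
  Q.IsDyadic ∧ (Eset Ebar ∩ Q.dilate 3).Subsingleton ∧
    ∀ Q' : Sq, Q'.IsDyadic → (Eset Ebar ∩ Q'.dilate 3).Subsingleton →
      Q.set ⊆ Q'.set → Q.set = Q'.set

/-- The shadow `π(Q)` of a square `Q`, where `π(x,y) = x`. -/
def shadow (Q : Sq) : Iv := ⟨Q.x, Q.s⟩

/-- `Ē⁺ = Ē ∪ {-1}`. -/
noncomputable def EbarPlus (Ebar : Finset ℝ) : Finset ℝ := insert (-1) Ebar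

/-- `I` is a shadow of some CZ square. -/
def IsShadow (Ebar : Finset ℝ) (I : Iv) : Prop :=
  ∃ Q : Sq, CZ Ebar Q ∧ shadow Q = I

/-- The group `Gp(x*)`: the set of shadows `I` of CZ squares such that
(a) `x* ≤ inf 41I` (note `inf 41I = I.a - 20·|I|`), and
(b) `Ē⁺ ∩ (x*, inf 9I] = ∅` (note `inf 9I = I.a - 4·|I|`). -/
def Gp (Ebar : Finset ℝ) (xstar : ℝ) (I : Iv) : Prop :=
  IsShadow Ebar I ∧ xstar ≤ I.a - 20 * I.len ∧
    ∀ x ∈ EbarPlus Ebar, ¬(xstar < x ∧ x ≤ I.a - 4 * I.len)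

/-- A shadow `I` is *easy* (for the parameter `K`) if `diam(Ē⁺ ∩ KI) ≥ K⁻¹·|I|`. -/
def EasyShadow (Ebar : Finset ℝ) (K : ℝ) (I : Iv) : Prop :=
  ∃ u ∈ EbarPlus Ebar, ∃ v ∈ EbarPlus Ebar,
    u ∈ I.dil K ∧ v ∈ I.dil K ∧ K⁻¹ * I.len ≤ |u - v|

/-- The square `Q_inner = [-2^{-10}, 2^{-10}]²`. -/
def Qinner : Set (ℝ × ℝ) :=
  Set.Icc (-(2 : ℝ) ^ (-(10 : ℤ))) ((2 : ℝ) ^ (-(10 : ℤ))) ×ˢ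
    Set.Icc (-(2 : ℝ) ^ (-(10 : ℤ))) ((2 : ℝ) ^ (-(10 : ℤ)))

/-- A CZ square is *relevant* if `1.1Q ∩ Q_inner ≠ ∅`. -/
def Relevant (Ebar : Finset ℝ) (Q : Sq) : Prop :=
  CZ Ebar Q ∧ (Q.dilate 1.1 ∩ Qinner).Nonempty

theorem two_mul_zpow_le_of_lt {a b : ℤ} (h : (2 : ℝ) ^ a < 2 ^ b) :
    2 * (2 : ℝ) ^ a ≤ 2 ^ b := by
  have hab : a < b := (zpow_lt_zpow_iff_right₀ (by norm_num)).1 h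
  calc 2 * (2 : ℝ) ^ a = 2 ^ (a + 1) := by rw [zpow_add_one₀ (by norm_num)]; ring
    _ ≤ 2 ^ b := zpow_le_zpow_right₀ (by norm_num) hab

theorem Sq.IsDyadic.exists_side_eq_zpow {Q : Sq} (hQ : Q.IsDyadic) :
    ∃ n : ℤ, Q.s = (2 : ℝ) ^ n := by
  rcases hQ with ⟨-, -, hs⟩ | ⟨k, i, j, -, -, -, -, -, -, hs⟩
  · exact ⟨1, by simpa using hs⟩
  · exact ⟨_, hs⟩

/-- Containment of squares in terms of corners. -/
theorem Sq.set_subset_set_iff {Q R : Sq} (hQ : 0 ≤ Q.s) :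
    Q.set ⊆ R.set ↔
      (R.x ≤ Q.x ∧ Q.x + Q.s ≤ R.x + R.s) ∧ R.y ≤ Q.y ∧ Q.y + Q.s ≤ R.y + R.s := by
  unfold Sq.set
  rw [Set.prod_subset_prod_iff, Set.Icc_subset_Icc_iff (by linarith),
    Set.Icc_subset_Icc_iff (by linarith)]
  simp [Set.Icc_eq_empty_iff, hQ]

/-- The level-`(m + 1)` dyadic interval of index `i` lies in the level-`m` one of index `i / 2`. -/
theorem dyadic_parent_bounds (m : ℕ) (i : ℤ) :
    ((i / 2 : ℤ) : ℝ) * 2 ^ (-(m : ℤ)) ≤ i * 2 ^ (-((m + 1 : ℕ) : ℤ)) ∧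
      (i : ℝ) * 2 ^ (-((m + 1 : ℕ) : ℤ)) + 2 ^ (-((m + 1 : ℕ) : ℤ)) ≤
        ((i / 2 : ℤ) : ℝ) * 2 ^ (-(m : ℤ)) + 2 ^ (-(m : ℤ)) := by
  have hp : (0 : ℝ) < 2 ^ (-((m + 1 : ℕ) : ℤ)) := by positivity
  have hm : (2 : ℝ) ^ (-(m : ℤ)) = 2 * 2 ^ (-((m + 1 : ℕ) : ℤ)) := by
    rw [← zpow_one_add₀ (by norm_num)]; congr 1; push_cast; ring
  have h₁ : (2 : ℝ) * ((i / 2 : ℤ) : ℝ) ≤ i := by exact_mod_cast (by omega : 2 * (i / 2) ≤ i)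
  have h₂ : (i : ℝ) ≤ 2 * ((i / 2 : ℤ) : ℝ) + 1 := by
    exact_mod_cast (by omega : i ≤ 2 * (i / 2) + 1)
  rw [hm]
  constructor <;> nlinarith

/-- The dyadic parent of a shadow of length at most `1/4` is again a shadow: above it, the square
in the second row over the axis is a CZ square. -/
theorem IsShadow.exists_parent {Ebar : Finset ℝ} {I : Iv} (hI : IsShadow Ebar I)
    (hlen : I.len ≤ 1 / 4) :
    ∃ P : Iv, P.IsDyadic ∧ P.len = 2 * I.len ∧ I.set ⊆ P.set ∧ IsShadow Ebar P := by
  obtain ⟨Q, ⟨hQd, -, hQmax⟩, rfl⟩ := hI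
  simp only [shadow] at hlen ⊢
  rcases hQd with ⟨-, -, hs⟩ | ⟨k, i, j, hi, hi', hj, hj', hx, hy, hs⟩
  · linarith
  obtain ⟨m, rfl⟩ : ∃ m, k = m + 1 := by
    refine Nat.exists_eq_succ_of_ne_zero ?_
    rintro rfl
    norm_num at hs
    linarith
  have hm : (2 : ℝ) ^ (-(m : ℤ)) = 2 * Q.s := by
    rw [hs, ← zpow_one_add₀ (by norm_num)]; congr 1; push_cast; ring
  have hm0 : m ≠ 0 := by
    rintro rfl
    norm_num at hm
    linarith
  have hm1 : (1 : ℤ) < 2 ^ m := one_lt_pow₀ (by norm_num) hm0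
  have hs0 : 0 < Q.s := hs ▸ by positivity
  rw [pow_succ] at hi hi' hj hj'
  obtain ⟨hxl, hxr⟩ := dyadic_parent_bounds m i
  obtain ⟨hyl, hyr⟩ := dyadic_parent_bounds m j
  rw [← hx] at hxl hxr
  rw [← hy] at hyl hyr
  rw [← hs] at hxr hyr
  set px : ℝ := ((i / 2 : ℤ) : ℝ) * 2 ^ (-(m : ℤ)) with hpx
  set py : ℝ := ((j / 2 : ℤ) : ℝ) * 2 ^ (-(m : ℤ)) with hpy
  have hcrowded : ¬(Eset Ebar ∩ Sq.dilate ⟨px, py, 2 * Q.s⟩ 3).Subsingleton := by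
    intro hsub
    have hle : Q.set ⊆ Sq.set ⟨px, py, 2 * Q.s⟩ :=
      (Sq.set_subset_set_iff hs0.le).2
        ⟨⟨hxl, by simpa [hm] using hxr⟩, hyl, by simpa [hm] using hyr⟩
    have heq := hQmax ⟨px, py, 2 * Q.s⟩
      (Or.inr ⟨m, i / 2, j / 2, by omega, by omega, by omega, by omega, hpx, hpy, hm.symm⟩)
      hsub hle
    have := (Sq.set_subset_set_iff (Q := ⟨px, py, 2 * Q.s⟩) (R := Q) (by simpa using hs0.le)).1
      heq.ge
    simp only at this
    linarith [this.1.1, this.1.2]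
  refine ⟨⟨px, 2 * Q.s⟩, Or.inr ⟨m, i / 2, by omega, by omega, hpx, hm.symm⟩, rfl,
    Set.Icc_subset_Icc hxl (by simpa [hm] using hxr), ⟨px, 2 * Q.s, 2 * Q.s⟩, ⟨?_, ?_, ?_⟩, rfl⟩
  · exact Or.inr ⟨m, i / 2, 1, by omega, by omega, by omega, hm1, hpx, by simp [hm], hm.symm⟩
  · rintro z ⟨⟨-, hz⟩, -, hz'⟩
    have := hz'.1
    simp only at this
    linarith
  · intro R hR hRsub hle
    have hle' := (Sq.set_subset_set_iff (by simpa using hs0.le)).1 hle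
    simp only at hle'
    obtain ⟨⟨h₁, h₂⟩, h₃, h₄⟩ := hle'
    rcases eq_or_lt_of_le (show 2 * Q.s ≤ R.s by linarith) with h | h
    · refine hle.antisymm ((Sq.set_subset_set_iff (by linarith)).2 ?_)
      refine ⟨⟨?_, ?_⟩, ?_, ?_⟩ <;> simp only <;> linarith
    · have hbig : 2 * (2 * Q.s) ≤ R.s := by
        obtain ⟨n, hn⟩ := hR.exists_side_eq_zpow
        rw [hn, ← hm] at h ⊢
        exact two_mul_zpow_le_of_lt h
      refine absurd (hRsub.anti ?_) hcrowded
      rintro z ⟨⟨hzE, hz0⟩, hzx, -⟩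
      simp only [Set.mem_Ioo] at hzx
      refine ⟨⟨hzE, hz0⟩, ⟨?_, ?_⟩, ?_, ?_⟩ <;> linarith [hzx.1, hzx.2]

theorem IsShadow.len_pos {Ebar : Finset ℝ} {I : Iv} (hI : IsShadow Ebar I) : 0 < I.len := by
  obtain ⟨Q, ⟨hQ, -⟩, rfl⟩ := hI
  obtain ⟨n, hn⟩ := hQ.exists_side_eq_zpow
  simp only [shadow, hn]
  positivity

theorem IsShadow.right_le_one {Ebar : Finset ℝ} {I : Iv} (hI : IsShadow Ebar I) :
    I.a + I.len ≤ 1 := by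
  obtain ⟨Q, ⟨hQ, -⟩, rfl⟩ := hI
  simp only [shadow]
  rcases hQ with ⟨hx, -, hs⟩ | ⟨k, i, j, -, hi, -, -, hx, -, hs⟩
  · linarith
  · have hi' : (i : ℝ) + 1 ≤ 2 ^ k := by exact_mod_cast hi
    calc Q.x + Q.s = (i + 1) * 2 ^ (-(k : ℤ)) := by rw [hx, hs]; ring
      _ ≤ 2 ^ k * 2 ^ (-(k : ℤ)) := by gcongr
      _ = 1 := by rw [zpow_neg, zpow_natCast]; exact mul_inv_cancel₀ (by positivity)

theorem EbarHyp.neg_one_le {Ebar : Finset ℝ} (hE : EbarHyp Ebar) {x : ℝ}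
    (hx : x ∈ EbarPlus Ebar) : -1 ≤ x := by
  rcases Finset.mem_insert.1 hx with rfl | hx
  · exact le_rfl
  · have := (hE.2.2.2 x hx).1
    norm_num at this
    linarith

/-- let `x* ∈ Ē⁺` and let `I₀ ⊂ I₁ ⊂ … ⊂ I_L` be a chain in `Gp(x*)` where
`I₀` has minimal length in `Gp(x*)`, each `I_{ℓ+1}` is the dyadic parent of `I_ℓ` (the
dyadic interval of length `2|I_ℓ|` containing `I_ℓ`), and `L` is maximal (no dyadic parent
of `I_L` belongs to `Gp(x*)`). Then `|I_L| ≥ (1/42)·dist(x*, I₀)`. -/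
theorem top_of_chain_is_large (Ebar : Finset ℝ) (hE : EbarHyp Ebar)
    (xstar : ℝ) (hx : xstar ∈ EbarPlus Ebar)
    (L : ℕ) (I : ℕ → Iv)
    (hmin : ∀ J : Iv, Gp Ebar xstar J → (I 0).len ≤ J.len)
    (hGp : ∀ l ≤ L, Gp Ebar xstar (I l))
    (hparent : ∀ l < L, (I (l + 1)).IsDyadic ∧ (I (l + 1)).len = 2 * (I l).len ∧
      (I l).set ⊆ (I (l + 1)).set)
    (hmax : ∀ P : Iv, P.IsDyadic → P.len = 2 * (I L).len → (I L).set ⊆ P.set →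
      ¬Gp Ebar xstar P) :
    Metric.infDist xstar (I 0).set / 42 ≤ (I L).len := by
  have hchain : ∀ l ≤ L, (I 0).set ⊆ (I l).set := by
    intro l
    induction l with
    | zero => exact fun _ => subset_rfl
    | succ n ih => exact fun hn => (ih (by omega)).trans (hparent n hn).2.2
  obtain ⟨hsh, hfar, hempty⟩ := hGp L le_rfl
  have hpos := hsh.len_pos
  have hpos₀ := (hGp 0 L.zero_le).1.len_pos
  have hsmall : (I L).len ≤ 1 / 4 := by
    linarith [hsh.right_le_one, hE.neg_one_le hx]
  obtain ⟨P, hPd, hPlen, hPsub, hPsh⟩ := hsh.exists_parent hsmall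
  obtain ⟨hPl, hPr⟩ := (Set.Icc_subset_Icc_iff (by linarith)).1 hPsub
  obtain ⟨-, hIr⟩ := (Set.Icc_subset_Icc_iff (by linarith)).1 (hchain L le_rfl)
  have hdist : Metric.infDist xstar (I 0).set ≤ (I 0).a - xstar := by
    refine (Metric.infDist_le_dist_of_mem (Set.left_mem_Icc.2 (by linarith))).trans_eq ?_
    rw [dist_comm, Real.dist_eq, abs_of_nonneg]
    linarith [(hGp 0 L.zero_le).2.1]
  by_contra! hlt
  refine hmax P hPd hPlen hPsub ⟨hPsh, by linarith, ?_⟩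
  rintro x hxE ⟨hx₁, hx₂⟩
  exact hempty x hxE ⟨hx₁, by linarith⟩
end

section
/- There exist absolute constants K₀ ≥ 41 and C > 0 such that for every K ≥ K₀ the following holds. Let z* = (x*, 0) with x* ∈ Ē⁺ and suppose GP(z*) ≠ ∅. Then there exist an integer L ≥ 0 and Calderón–Zygmund squares Q₀, Q₁, …, Q_L ∈ GP(z*) with the following properties: (i) δ_{Q_ℓ} = 2^ℓ · δ_{Q₀} for 0 ≤ ℓ ≤ L; (ii) Q_ℓ ⊂ C·Q_{ℓ'} whenever ℓ < ℓ'; (iii) Q_L is easy; (iv) for every hard Q ∈ GP(z*), there exists ℓ with 0 ≤ ℓ ≤ L−1 such that δ_Q = δ_{Q_ℓ} and 100Q ∩ 100Q_ℓ ≠ ∅. -/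
/-- The index data of a member of the group `Gp(x*)`: the dyadic interval
`[i·2^{-k}, (i+1)·2^{-k}]` satisfies the two positional conditions, and the triple of its parent
contains two distinct points of `Ē`. -/
structure GroupIdx (Ebar : Finset ℝ) (xstar : ℝ) (k : ℕ) (i : ℤ) : Prop where
  lower : -(2 ^ k : ℤ) ≤ i
  upper : i < 2 ^ k
  pair : ∃ u ∈ Ebar, ∃ v ∈ Ebar, u ≠ v ∧
    (2 * ((i / 2 : ℤ) : ℝ) - 2) * (2 : ℝ) ^ (-(k : ℤ)) < u ∧
    u < (2 * ((i / 2 : ℤ) : ℝ) + 4) * (2 : ℝ) ^ (-(k : ℤ)) ∧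
    (2 * ((i / 2 : ℤ) : ℝ) - 2) * (2 : ℝ) ^ (-(k : ℤ)) < v ∧
    v < (2 * ((i / 2 : ℤ) : ℝ) + 4) * (2 : ℝ) ^ (-(k : ℤ))
  left : xstar ≤ ((i : ℝ) - 20) * (2 : ℝ) ^ (-(k : ℤ))
  gap : ∀ x ∈ EbarPlus Ebar, ¬(xstar < x ∧ x ≤ ((i : ℝ) - 4) * (2 : ℝ) ^ (-(k : ℤ)))

lemma two_mul_half_bounds (i : ℤ) :
    (i : ℝ) - 1 ≤ 2 * ((i / 2 : ℤ) : ℝ) ∧ 2 * ((i / 2 : ℤ) : ℝ) ≤ i := by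
  have h1 : i - 1 ≤ 2 * (i / 2) := by omega
  have h2 : 2 * (i / 2) ≤ i := by omega
  exact ⟨by exact_mod_cast h1, by exact_mod_cast h2⟩

lemma two_zpow_neg_succ (k : ℕ) :
    (2 : ℝ) ^ (-(k : ℤ)) = 2 * (2 : ℝ) ^ (-((k + 1 : ℕ) : ℤ)) := by
  rw [show -(k : ℤ) = -((k + 1 : ℕ) : ℤ) + 1 by push_cast; ring, zpow_add₀ (by norm_num)]
  ring

lemma two_zpow_neg_add (k n : ℕ) :
    (2 : ℝ) ^ (-(k : ℤ)) = 2 ^ n * (2 : ℝ) ^ (-((k + n : ℕ) : ℤ)) := by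
  rw [← zpow_natCast, ← zpow_add₀ (by norm_num)]
  congr 1
  push_cast
  ring

namespace Sq

lemma set_subset_iff {Q R : Sq} (hQ : 0 ≤ Q.s) :
    Q.set ⊆ R.set ↔ (R.x ≤ Q.x ∧ Q.x + Q.s ≤ R.x + R.s) ∧ (R.y ≤ Q.y ∧ Q.y + Q.s ≤ R.y + R.s) := by
  unfold set
  rw [Set.prod_subset_prod_iff, Set.Icc_subset_Icc_iff (by linarith),
    Set.Icc_subset_Icc_iff (by linarith)]
  have h1 : ¬ Set.Icc Q.x (Q.x + Q.s) = ∅ := by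
    simpa [Set.Icc_eq_empty_iff] using hQ
  have h2 : ¬ Set.Icc Q.y (Q.y + Q.s) = ∅ := by
    simpa [Set.Icc_eq_empty_iff] using hQ
  tauto

end Sq

/-- Two distinct points of `Ē` on the axis prevent a square's triple from being admissible. -/
lemma not_subsingleton_of_pair {Ebar : Finset ℝ} {Q : Sq} {u v : ℝ} (hu : u ∈ Ebar)
    (hv : v ∈ Ebar) (huv : u ≠ v)
    (hu1 : Q.x - Q.s < u) (hu2 : u < Q.x + 2 * Q.s)
    (hv1 : Q.x - Q.s < v) (hv2 : v < Q.x + 2 * Q.s)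
    (hy1 : Q.y - Q.s < 0) (hy2 : 0 < Q.y + 2 * Q.s) :
    ¬ (Eset Ebar ∩ Q.dilate 3).Subsingleton := by
  intro h
  have := @h (u, 0) ⟨⟨hu, rfl⟩, ⟨⟨by dsimp only; linarith, by dsimp only; linarith⟩,
    ⟨by dsimp only; linarith, by dsimp only; linarith⟩⟩⟩ (v, 0) ⟨⟨hv, rfl⟩,
    ⟨⟨by dsimp only; linarith, by dsimp only; linarith⟩,
    ⟨by dsimp only; linarith, by dsimp only; linarith⟩⟩⟩
  exact huv (congrArg Prod.fst this)

lemma pair_of_not_subsingleton {Ebar : Finset ℝ} {Q : Sq}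
    (h : ¬ (Eset Ebar ∩ Q.dilate 3).Subsingleton) :
    (Q.y - Q.s < 0 ∧ 0 < Q.y + 2 * Q.s) ∧ ∃ u ∈ Ebar, ∃ v ∈ Ebar, u ≠ v ∧
      Q.x - Q.s < u ∧ u < Q.x + 2 * Q.s ∧ Q.x - Q.s < v ∧ v < Q.x + 2 * Q.s := by
  rw [Set.not_subsingleton_iff] at h
  obtain ⟨⟨u, a⟩, ⟨⟨hu, ha⟩, ⟨⟨h1, h2⟩, ⟨h3, h4⟩⟩⟩, ⟨v, b⟩, ⟨⟨hv, hb⟩, ⟨⟨h5, h6⟩, -⟩⟩, hne⟩ := h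
  dsimp only at *
  subst ha hb
  refine ⟨⟨by linarith, by linarith⟩, u, hu, v, hv, ?_, by linarith, by linarith, by linarith,
    by linarith⟩
  rintro rfl
  exact hne rfl

lemma not_subsingleton_of_large {Ebar : Finset ℝ} (hE : EbarHyp Ebar) {Q : Sq}
    (hx1 : Q.x - Q.s ≤ -1) (hx2 : 1 ≤ Q.x + 2 * Q.s)
    (hy1 : Q.y - Q.s < 0) (hy2 : 0 < Q.y + 2 * Q.s) :
    ¬ (Eset Ebar ∩ Q.dilate 3).Subsingleton := by
  obtain ⟨-, h1, h2, -⟩ := hE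
  norm_num at h1 h2
  refine not_subsingleton_of_pair h1 h2 (by norm_num) ?_ ?_ ?_ ?_ hy1 hy2 <;> linarith

lemma CZ.exists_index {Ebar : Finset ℝ} (hE : EbarHyp Ebar) {Q : Sq} (hQ : CZ Ebar Q) :
    ∃ (k : ℕ) (i : ℤ), 1 ≤ k ∧ -(2 ^ k : ℤ) ≤ i ∧ i < 2 ^ k ∧
      Q.x = (i : ℝ) * (2 : ℝ) ^ (-(k : ℤ)) ∧ Q.s = (2 : ℝ) ^ (-(k : ℤ)) ∧
      -4 * Q.s ≤ Q.y ∧ Q.y ≤ 3 * Q.s ∧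
      ∃ u ∈ Ebar, ∃ v ∈ Ebar, u ≠ v ∧
        (2 * ((i / 2 : ℤ) : ℝ) - 2) * (2 : ℝ) ^ (-(k : ℤ)) < u ∧
        u < (2 * ((i / 2 : ℤ) : ℝ) + 4) * (2 : ℝ) ^ (-(k : ℤ)) ∧
        (2 * ((i / 2 : ℤ) : ℝ) - 2) * (2 : ℝ) ^ (-(k : ℤ)) < v ∧
        v < (2 * ((i / 2 : ℤ) : ℝ) + 4) * (2 : ℝ) ^ (-(k : ℤ)) := by
  obtain ⟨hd, hs, hmax⟩ := hQ
  rcases hd with ⟨hx, hy, hl⟩ | ⟨k, i, j, hi1, hi2, hj1, hj2, hx, hy, hl⟩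
  · exact absurd hs (not_subsingleton_of_large hE (by linarith) (by linarith) (by linarith)
      (by linarith))
  rcases k with _ | k
  · simp only [pow_zero, Nat.cast_zero, neg_zero, zpow_zero, mul_one] at *
    have a1 : (-1 : ℝ) ≤ i := by exact_mod_cast hi1
    have a2 : (i : ℝ) ≤ 0 := by exact_mod_cast (by omega : i ≤ 0)
    have b1 : (-1 : ℝ) ≤ j := by exact_mod_cast hj1
    have b2 : (j : ℝ) ≤ 0 := by exact_mod_cast (by omega : j ≤ 0)
    exact absurd hs (not_subsingleton_of_large hE (by linarith) (by linarith) (by linarith)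
      (by linarith))
  have hD := two_zpow_neg_succ k
  set D := (2 : ℝ) ^ (-((k + 1 : ℕ) : ℤ)) with hDdef
  have hD0 : 0 < D := by positivity
  obtain ⟨i1, i2⟩ := two_mul_half_bounds i
  obtain ⟨j1, j2⟩ := two_mul_half_bounds j
  rw [pow_succ] at hi1 hi2 hj1 hj2
  have i3 : (i : ℝ) + 1 ≤ 2 * ((i / 2 : ℤ) : ℝ) + 2 := by linarith
  have j3 : (j : ℝ) + 1 ≤ 2 * ((j / 2 : ℤ) : ℝ) + 2 := by linarith
  let P : Sq := ⟨((i / 2 : ℤ) : ℝ) * (2 : ℝ) ^ (-(k : ℤ)), ((j / 2 : ℤ) : ℝ) * (2 : ℝ) ^ (-(k : ℤ)),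
    (2 : ℝ) ^ (-(k : ℤ))⟩
  have hPd : P.IsDyadic := Or.inr ⟨k, i / 2, j / 2, by omega, by omega, by omega, by omega,
    rfl, rfl, rfl⟩
  have hPx : P.x = 2 * ((i / 2 : ℤ) : ℝ) * D := by simp only [P, hD]; ring
  have hPy : P.y = 2 * ((j / 2 : ℤ) : ℝ) * D := by simp only [P, hD]; ring
  have hPs : P.s = 2 * D := hD
  have hQP : Q.set ⊆ P.set := by
    rw [Sq.set_subset_iff (by linarith), hPx, hPy, hPs, hx, hy, hl]
    refine ⟨⟨?_, ?_⟩, ?_, ?_⟩ <;> nlinarith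
  have hP : ¬ (Eset Ebar ∩ P.dilate 3).Subsingleton := by
    intro h
    have h' := (hmax P hPd h hQP).ge
    rw [Sq.set_subset_iff (by linarith)] at h'
    linarith [h'.1.1, h'.1.2]
  obtain ⟨⟨hy1, hy2⟩, u, hu, v, hv, huv, h1, h2, h3, h4⟩ := pair_of_not_subsingleton hP
  rw [hPx, hPs] at h1 h2 h3 h4
  rw [hPy, hPs] at hy1 hy2
  refine ⟨k + 1, i, by omega, by rw [pow_succ]; omega, by rw [pow_succ]; omega, hx, hl, ?_, ?_,
    u, hu, v, hv, huv, by linarith, by linarith, by linarith, by linarith⟩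
  · rw [hy, hl]; nlinarith
  · rw [hy, hl]; nlinarith

lemma CZ.exists_groupIdx {Ebar : Finset ℝ} (hE : EbarHyp Ebar) {xstar : ℝ} {Q : Sq}
    (hQ : CZ Ebar Q) (hG : Gp Ebar xstar (shadow Q)) :
    ∃ (k : ℕ) (i : ℤ), 1 ≤ k ∧ GroupIdx Ebar xstar k i ∧
      Q.x = (i : ℝ) * (2 : ℝ) ^ (-(k : ℤ)) ∧ Q.s = (2 : ℝ) ^ (-(k : ℤ)) ∧
      -4 * Q.s ≤ Q.y ∧ Q.y ≤ 3 * Q.s := by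
  obtain ⟨k, i, hk, hi1, hi2, hx, hl, hy1, hy2, hp⟩ := hQ.exists_index hE
  obtain ⟨-, ha, hb⟩ := hG
  simp only [shadow, hx, hl] at ha hb
  refine ⟨k, i, hk, ⟨hi1, hi2, hp, by linarith, fun x hx h => hb x hx ⟨h.1, by linarith [h.2]⟩⟩,
    hx, hl, hy1, hy2⟩

/-- The dyadic square above the interval with index `(k, i)`, one side length above the axis. -/
noncomputable def squareAbove (k : ℕ) (i : ℤ) : Sq :=
  ⟨(i : ℝ) * (2 : ℝ) ^ (-(k : ℤ)), (2 : ℝ) ^ (-(k : ℤ)), (2 : ℝ) ^ (-(k : ℤ))⟩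

namespace GroupIdx

variable {Ebar : Finset ℝ} {xstar : ℝ} {k : ℕ} {i : ℤ}

lemma cz_squareAbove (h : GroupIdx Ebar xstar k i) (hE : EbarHyp Ebar) (hk : 1 ≤ k) :
    CZ Ebar (squareAbove k i) := by
  obtain ⟨u, hu, v, hv, huv, h1, h2, h3, h4⟩ := h.pair
  have hD0 : 0 < (2 : ℝ) ^ (-(k : ℤ)) := by positivity
  refine ⟨Or.inr ⟨k, i, 1, h.lower, h.upper, ?_, ?_, rfl, by simp [squareAbove], rfl⟩, ?_, ?_⟩
  · have : (0 : ℤ) < 2 ^ k := by positivity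
    omega
  · exact one_lt_pow₀ (by norm_num) (by omega)
  · rintro ⟨a, b⟩ ⟨⟨-, hb⟩, -, h5, -⟩
    simp only [squareAbove] at h5 hb
    linarith
  · intro R hR hRs hsub
    rw [Sq.set_subset_iff hD0.le] at hsub
    obtain ⟨⟨hx1, hx2⟩, hy1, hy2⟩ := hsub
    rcases hR with ⟨hx, hy, hl⟩ | ⟨m, i', j', -, -, -, -, hx, hy, hl⟩
    · exact absurd hRs (not_subsingleton_of_large hE (by linarith) (by linarith) (by linarith)
        (by linarith))
    simp only [squareAbove] at hx1 hx2 hy1 hy2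
    have hmk : m ≤ k := by
      have : (2 : ℝ) ^ (-(k : ℤ)) ≤ (2 : ℝ) ^ (-(m : ℤ)) := by rw [← hl]; linarith
      have := (zpow_le_zpow_iff_right₀ (by norm_num : (1 : ℝ) < 2)).1 this
      omega
    obtain ⟨n, rfl⟩ := Nat.exists_eq_add_of_le hmk
    rw [two_zpow_neg_add m n] at hx hy hl
    set D := (2 : ℝ) ^ (-((m + n : ℕ) : ℤ)) with hD
    rw [hx, hl] at hx2
    rw [hx] at hx1
    rw [hy, hl] at hy2
    rw [hy] at hy1
    have ex1 : (i' : ℝ) * 2 ^ n ≤ i := le_of_mul_le_mul_right (by linarith) hD0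
    have ex2 : (i : ℝ) + 1 ≤ (i' + 1) * 2 ^ n := le_of_mul_le_mul_right (by linarith) hD0
    have ey1 : (j' : ℝ) * 2 ^ n ≤ 1 := le_of_mul_le_mul_right (by linarith) hD0
    have ey2 : (2 : ℝ) ≤ (j' + 1) * 2 ^ n := le_of_mul_le_mul_right (by linarith) hD0
    rcases n with _ | n
    · have e1 : (i' : ℝ) = i := by linarith
      have e2 : (j' : ℝ) = 1 := by linarith
      simp only [squareAbove, Sq.set, ← hD, hx, hy, hl, e1, e2, pow_zero, one_mul]
    · have fx1 : i' * (2 ^ n * 2) ≤ i := by rw [← pow_succ]; exact_mod_cast ex1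
      have fx2 : i + 1 ≤ (i' + 1) * (2 ^ n * 2) := by rw [← pow_succ]; exact_mod_cast ex2
      have fy1 : j' * (2 ^ n * 2) ≤ 1 := by rw [← pow_succ]; exact_mod_cast ey1
      have fy2 : 2 ≤ (j' + 1) * (2 ^ n * 2) := by rw [← pow_succ]; exact_mod_cast ey2
      have hn1 : (1 : ℤ) ≤ 2 ^ n := one_le_pow₀ (by norm_num)
      rw [← mul_assoc] at fx1 fx2 fy1 fy2
      have gx1 : i' * 2 ^ n ≤ i / 2 := by omega
      have gx2 : i / 2 + 1 ≤ (i' + 1) * 2 ^ n := by omega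
      have gy1 : j' * 2 ^ n ≤ 0 := by omega
      have gy2 : 1 ≤ (j' + 1) * 2 ^ n := by omega
      have kx1 : (i' : ℝ) * 2 ^ n ≤ ((i / 2 : ℤ) : ℝ) := by exact_mod_cast gx1
      have kx2 : ((i / 2 : ℤ) : ℝ) + 1 ≤ (i' + 1) * 2 ^ n := by exact_mod_cast gx2
      have ky1 : (j' : ℝ) * 2 ^ n ≤ 0 := by exact_mod_cast gy1
      have ky2 : (1 : ℝ) ≤ (j' + 1) * 2 ^ n := by exact_mod_cast gy2
      have kn : (1 : ℝ) ≤ 2 ^ n := by exact_mod_cast hn1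
      have lo : R.x - R.s ≤ (2 * ((i / 2 : ℤ) : ℝ) - 2) * D := by
        rw [hx, hl, pow_succ]
        have : ((i' : ℝ) - 1) * 2 ^ n * 2 * D ≤ (2 * ((i / 2 : ℤ) : ℝ) - 2) * D :=
          mul_le_mul_of_nonneg_right (by linarith) hD0.le
        linarith
      have hi : (2 * ((i / 2 : ℤ) : ℝ) + 4) * D ≤ R.x + 2 * R.s := by
        rw [hx, hl, pow_succ]
        have : (2 * ((i / 2 : ℤ) : ℝ) + 4) * D ≤ ((i' : ℝ) + 2) * 2 ^ n * 2 * D :=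
          mul_le_mul_of_nonneg_right (by linarith) hD0.le
        linarith
      refine absurd hRs (not_subsingleton_of_pair hu hv huv (by linarith) (by linarith)
        (by linarith) (by linarith) ?_ ?_)
      · rw [hy, hl, pow_succ]
        have : ((j' : ℝ) - 1) * 2 ^ n * D < 0 := mul_neg_of_neg_of_pos (by linarith) hD0
        linarith
      · rw [hy, hl, pow_succ]
        have : 0 < ((j' : ℝ) + 2) * 2 ^ n * D := mul_pos (by linarith) hD0
        linarith

lemma gp_squareAbove (h : GroupIdx Ebar xstar k i) (hE : EbarHyp Ebar) (hk : 1 ≤ k) :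
    Gp Ebar xstar (shadow (squareAbove k i)) := by
  refine ⟨⟨_, h.cz_squareAbove hE hk, rfl⟩, ?_, fun x hx hxx => h.gap x hx ⟨hxx.1, ?_⟩⟩
  · have := h.left
    simp only [shadow, squareAbove]
    linarith
  · have := hxx.2
    simp only [shadow, squareAbove] at this
    linarith

/-- If `x*` is far enough to the left, then the parent interval also belongs to the group. -/
lemma parent (h : GroupIdx Ebar xstar (k + 1) i)
    (hx : xstar ≤ ((i : ℝ) - 41) * (2 : ℝ) ^ (-((k + 1 : ℕ) : ℤ))) :
    GroupIdx Ebar xstar k (i / 2) := by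
  obtain ⟨u, hu, v, hv, huv, h1, h2, h3, h4⟩ := h.pair
  have hlo := h.lower
  have hup := h.upper
  have hgap := h.gap
  rw [pow_succ] at hlo hup
  have hD := two_zpow_neg_succ k
  have hD0 : 0 < (2 : ℝ) ^ (-((k + 1 : ℕ) : ℤ)) := by positivity
  obtain ⟨i1, i2⟩ := two_mul_half_bounds i
  obtain ⟨p1, p2⟩ := two_mul_half_bounds (i / 2)
  set D := (2 : ℝ) ^ (-((k + 1 : ℕ) : ℤ))
  have lo : (2 * ((i / 2 / 2 : ℤ) : ℝ) - 2) * (2 * D) ≤ (2 * ((i / 2 : ℤ) : ℝ) - 2) * D := by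
    nlinarith
  have hi : (2 * ((i / 2 : ℤ) : ℝ) + 4) * D ≤ (2 * ((i / 2 / 2 : ℤ) : ℝ) + 4) * (2 * D) := by
    nlinarith
  refine ⟨by omega, by omega, ⟨u, hu, v, hv, huv, ?_⟩, ?_, fun x hxE hxx => hgap x hxE
    ⟨hxx.1, hxx.2.trans ?_⟩⟩
  · rw [hD]
    exact ⟨by linarith, by linarith, by linarith, by linarith⟩
  · rw [hD]
    nlinarith
  · rw [hD]
    nlinarith

/-- A group interval is close to a point of `Ē` lying to the right of `x*`. -/
lemma exists_near (h : GroupIdx Ebar xstar k i) :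
    ∃ u ∈ Ebar, xstar < u ∧ ((i : ℝ) - 3) * (2 : ℝ) ^ (-(k : ℤ)) < u ∧
      u < ((i : ℝ) + 4) * (2 : ℝ) ^ (-(k : ℤ)) := by
  obtain ⟨u, hu, v, hv, huv, h1, h2, h3, h4⟩ := h.pair
  obtain ⟨i1, i2⟩ := two_mul_half_bounds i
  have hl := h.left
  have hD0 : 0 < (2 : ℝ) ^ (-(k : ℤ)) := by positivity
  have h5 : ((i : ℝ) - 3) * (2 : ℝ) ^ (-(k : ℤ)) < u := by nlinarith
  exact ⟨u, hu, by nlinarith, h5, by nlinarith⟩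

/-- The left end of `9J` lies to the left of the right end of `7I`, for any two group intervals
`I` and `J`. -/
lemma left_lt (h : GroupIdx Ebar xstar k i) {m : ℕ} {j : ℤ} (h' : GroupIdx Ebar xstar m j) :
    ((j : ℝ) - 4) * (2 : ℝ) ^ (-(m : ℤ)) < ((i : ℝ) + 4) * (2 : ℝ) ^ (-(k : ℤ)) := by
  obtain ⟨u, hu, hxu, -, h2⟩ := h.exists_near
  refine lt_trans ?_ h2
  by_contra! hc
  exact h'.gap u (Finset.mem_insert_of_mem hu) ⟨hxu, hc⟩

lemma four_le (h : GroupIdx Ebar xstar k i) (hE : EbarHyp Ebar) (hx : xstar ∈ EbarPlus Ebar) :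
    4 ≤ k := by
  obtain ⟨u, hu, hxu, h1, h2⟩ := h.exists_near
  have hu1 := (hE.2.2.2 u hu).2
  have hx1 : -1 ≤ xstar := by
    rcases Finset.mem_insert.1 hx with rfl | hx
    · exact le_rfl
    · have := (hE.2.2.2 _ hx).1
      norm_num at this
      linarith
  norm_num at hu1
  by_contra! hk
  have hD : (2 : ℝ) ^ (-(3 : ℤ)) ≤ (2 : ℝ) ^ (-(k : ℤ)) :=
    zpow_le_zpow_right₀ (by norm_num) (by omega)
  rw [show (2 : ℝ) ^ (-(3 : ℤ)) = 1 / 8 by norm_num] at hD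
  have := h.left
  linarith

/-- The parent of a hard group interval belongs to the group. -/
lemma parent_of_hard (h : GroupIdx Ebar xstar (k + 1) i) (hx : xstar ∈ EbarPlus Ebar) {K : ℝ}
    (hK : 100 ≤ K)
    (hhard : ¬ EasyShadow Ebar K
      ⟨(i : ℝ) * (2 : ℝ) ^ (-((k + 1 : ℕ) : ℤ)), (2 : ℝ) ^ (-((k + 1 : ℕ) : ℤ))⟩) :
    GroupIdx Ebar xstar k (i / 2) := by
  apply h.parent
  obtain ⟨u, hu, hxu, h1, h2⟩ := h.exists_near
  have hl := h.left
  have hD0 : 0 < (2 : ℝ) ^ (-((k + 1 : ℕ) : ℤ)) := by positivity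
  set D := (2 : ℝ) ^ (-((k + 1 : ℕ) : ℤ))
  have hKD : 100 * D ≤ K * D := by nlinarith
  by_contra! hc
  refine hhard ⟨u, Finset.mem_insert_of_mem hu, xstar, hx, ⟨?_, ?_⟩, ⟨?_, ?_⟩, ?_⟩
  · dsimp only; linarith
  · dsimp only; linarith
  · dsimp only; linarith
  · dsimp only; linarith
  · have hKi : K⁻¹ ≤ 1 := inv_le_one_of_one_le₀ (by linarith)
    have : K⁻¹ * D ≤ 1 * D := mul_le_mul_of_nonneg_right hKi hD0.le
    refine le_trans ?_ (le_abs_self _)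
    dsimp only
    linarith

/-- The group contains intervals of every intermediate length. -/
lemma parent_of_lt (h : GroupIdx Ebar xstar (k + 1) i) {m : ℕ} {j : ℤ}
    (h' : GroupIdx Ebar xstar m j) (hm : m < k) : GroupIdx Ebar xstar k (i / 2) := by
  apply h.parent
  have hlt := h.left_lt h'
  have hl := h'.left
  have hD : (2 : ℝ) ^ (-((k - 1 : ℕ) : ℤ)) ≤ (2 : ℝ) ^ (-(m : ℤ)) :=
    zpow_le_zpow_right₀ (by norm_num) (by omega)
  rw [two_zpow_neg_add (k - 1) 2, show k - 1 + 2 = k + 1 by omega] at hD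
  have hD0 : 0 < (2 : ℝ) ^ (-((k + 1 : ℕ) : ℤ)) := by positivity
  linarith

lemma level_bound (Ebar : Finset ℝ) (xstar : ℝ) :
    ∃ N : ℕ, ∀ k i, GroupIdx Ebar xstar k i → k ≤ N := by
  obtain ⟨r, hr, hsep⟩ : ∃ r > 0, ∀ u ∈ Ebar, ∀ v ∈ Ebar, u ≠ v → r ≤ |u - v| := by
    rcases Ebar.offDiag.eq_empty_or_nonempty with h0 | h0
    · refine ⟨1, one_pos, fun u hu v hv huv => ?_⟩
      have : (u, v) ∈ Ebar.offDiag := Finset.mem_offDiag.2 ⟨hu, hv, huv⟩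
      simp [h0] at this
    · obtain ⟨p, hp, hmin⟩ := Ebar.offDiag.exists_min_image (fun p => |p.1 - p.2|) h0
      refine ⟨|p.1 - p.2|, abs_pos.2 (sub_ne_zero.2 (Finset.mem_offDiag.1 hp).2.2),
        fun u hu v hv huv => hmin (u, v) (Finset.mem_offDiag.2 ⟨hu, hv, huv⟩)⟩
  obtain ⟨N, hN⟩ := exists_pow_lt_of_lt_one (show 0 < r / 6 by positivity)
    (show (1 / 2 : ℝ) < 1 by norm_num)
  refine ⟨N, fun k i h => ?_⟩
  obtain ⟨u, hu, v, hv, huv, h1, h2, h3, h4⟩ := h.pair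
  by_contra! hk
  have hD : (2 : ℝ) ^ (-(k : ℤ)) ≤ (2 : ℝ) ^ (-(N : ℤ)) :=
    zpow_le_zpow_right₀ (by norm_num) (by omega)
  rw [one_div, inv_pow, ← zpow_natCast, ← zpow_neg] at hN
  have h5 := hsep u hu v hv huv
  have h6 : |u - v| < 6 * (2 : ℝ) ^ (-(k : ℤ)) := abs_lt.2 ⟨by linarith, by linarith⟩
  linarith

end GroupIdx

/-- there are absolute constants `K₀ ≥ 41` and `C > 0` such that for every
`K ≥ K₀`, every admissible `Ē`, and every `x* ∈ Ē⁺` with `GP(z*) ≠ ∅` (where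
`GP(z*) = {Q ∈ CZ : π(Q) ∈ Gp(x*)}`), there exist `L ≥ 0` and CZ squares
`Q₀, …, Q_L ∈ GP(z*)` with:
(i) `δ_{Q_ℓ} = 2^ℓ δ_{Q₀}`; (ii) `Q_ℓ ⊂ C·Q_{ℓ'}` for `ℓ < ℓ'`; (iii) `Q_L` is easy;
(iv) every hard `Q ∈ GP(z*)` satisfies `δ_Q = δ_{Q_ℓ}` and `100Q ∩ 100Q_ℓ ≠ ∅` for some
`0 ≤ ℓ ≤ L-1`. -/
theorem group_structure :
    ∃ K₀ C : ℝ, 41 ≤ K₀ ∧ 0 < C ∧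
      ∀ K : ℝ, K₀ ≤ K →
      ∀ Ebar : Finset ℝ, EbarHyp Ebar →
      ∀ xstar ∈ EbarPlus Ebar,
      (∃ Q : Sq, CZ Ebar Q ∧ Gp Ebar xstar (shadow Q)) →
      ∃ (L : ℕ) (Qs : ℕ → Sq),
        (∀ l ≤ L, CZ Ebar (Qs l) ∧ Gp Ebar xstar (shadow (Qs l))) ∧
        (∀ l ≤ L, (Qs l).s = 2 ^ l * (Qs 0).s) ∧
        (∀ l l' : ℕ, l < l' → l' ≤ L → (Qs l).set ⊆ (Qs l').dilate C) ∧
        EasyShadow Ebar K (shadow (Qs L)) ∧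
        (∀ Q : Sq, CZ Ebar Q → Gp Ebar xstar (shadow Q) →
          ¬EasyShadow Ebar K (shadow Q) →
          ∃ l < L, Q.s = (Qs l).s ∧ (Q.dilate 100 ∩ (Qs l).dilate 100).Nonempty) := by
  refine ⟨100, 100, by norm_num, by norm_num, fun K hK Ebar hE xstar hxs ⟨Q, hQ, hQG⟩ => ?_⟩
  classical
  obtain ⟨N, hN⟩ := GroupIdx.level_bound Ebar xstar
  let P : ℕ → Prop := fun k => ∃ i, GroupIdx Ebar xstar k i
  have hP : ∃ k, P k := by
    obtain ⟨k, i, -, h, -⟩ := hQ.exists_groupIdx hE hQG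
    exact ⟨k, i, h⟩
  obtain ⟨k₁, hk₁, hmin⟩ : ∃ k, P k ∧ ∀ m, P m → k ≤ m :=
    ⟨Nat.find hP, Nat.find_spec hP, fun m hm => Nat.find_min' hP hm⟩
  obtain ⟨k₂, hk₂, hmax⟩ : ∃ k, P k ∧ ∀ m, P m → m ≤ k := by
    refine ⟨Nat.findGreatest P N, ?_, fun m ⟨i, hm⟩ => Nat.le_findGreatest (hN m i hm) ⟨i, hm⟩⟩
    obtain ⟨k, i, h⟩ := hP
    exact Nat.findGreatest_spec (hN k i h) ⟨i, h⟩
  have hk₁₂ : k₁ ≤ k₂ := hmin _ hk₂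
  have hall : ∀ l ≤ k₂ - k₁, P (k₂ - l) := by
    intro l
    induction l with
    | zero => exact fun _ => hk₂
    | succ l ih =>
      intro hl
      obtain ⟨i, hi⟩ := ih (by omega)
      rw [show k₂ - l = k₂ - (l + 1) + 1 by omega] at hi
      rcases Nat.lt_or_ge k₁ (k₂ - (l + 1)) with hlt | hge
      · obtain ⟨j, hj⟩ := hk₁
        exact ⟨_, hi.parent_of_lt hj hlt⟩
      · rwa [show k₂ - (l + 1) = k₁ by omega]
  choose! idx hidx using hall
  have hhard : ∀ k i, GroupIdx Ebar xstar k i →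
      ¬ EasyShadow Ebar K ⟨(i : ℝ) * (2 : ℝ) ^ (-(k : ℤ)), (2 : ℝ) ^ (-(k : ℤ))⟩ → k₁ < k := by
    intro k i h hh
    have h4 := h.four_le hE hxs
    obtain ⟨k, rfl⟩ := Nat.exists_eq_add_of_le' (show 1 ≤ k by omega)
    have := hmin k ⟨_, h.parent_of_hard hxs hK hh⟩
    omega
  have hone : ∀ l ≤ k₂ - k₁, 1 ≤ k₂ - l := fun l hl => by
    have := (hidx l hl).four_le hE hxs
    omega
  refine ⟨k₂ - k₁, fun l => squareAbove (k₂ - l) (idx l), fun l hl =>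
    ⟨(hidx l hl).cz_squareAbove hE (hone l hl), (hidx l hl).gp_squareAbove hE (hone l hl)⟩,
    fun l hl => ?_, fun l l' hll hl' => ?_, ?_, fun R hR hRG hRh => ?_⟩
  · have := two_zpow_neg_add (k₂ - l) l
    rwa [show k₂ - l + l = k₂ by omega] at this
  · have h1 := (hidx l (by omega)).left_lt (hidx l' hl')
    have h2 := (hidx l' hl').left_lt (hidx l (by omega))
    have hD0 : 0 < (2 : ℝ) ^ (-((k₂ - l : ℕ) : ℤ)) := by positivity
    have hDD : (2 : ℝ) ^ (-((k₂ - l : ℕ) : ℤ)) ≤ (2 : ℝ) ^ (-((k₂ - l' : ℕ) : ℤ)) :=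
      zpow_le_zpow_right₀ (by norm_num) (by omega)
    rintro ⟨a, b⟩ ⟨⟨ha1, ha2⟩, hb1, hb2⟩
    simp only [squareAbove] at ha1 ha2 hb1 hb2
    refine ⟨⟨?_, ?_⟩, ?_, ?_⟩ <;> simp only [squareAbove] <;> linarith
  · by_contra hh
    have := hhard _ _ (hidx _ le_rfl) hh
    omega
  · obtain ⟨k, i, -, h, hx, hs, hy1, hy2⟩ := hR.exists_groupIdx hE hRG
    rw [shadow, hx, hs] at hRh
    have hlt := hhard k i h hRh
    have hle := hmax k ⟨i, h⟩
    obtain ⟨l, hl⟩ : ∃ l, l = k₂ - k := ⟨_, rfl⟩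
    have hkl : k₂ - l = k := by omega
    have h' := hidx l (by omega)
    rw [hkl] at h'
    have h1 := h.left_lt h'
    have h2 := h'.left_lt h
    have hD0 : 0 < (2 : ℝ) ^ (-(k : ℤ)) := by positivity
    refine ⟨l, by omega, by rw [hs, ← hkl]; rfl, (R.x, 0), ⟨⟨?_, ?_⟩, ?_, ?_⟩, ⟨?_, ?_⟩, ?_, ?_⟩ <;>
      rw [hs] at hy1 hy2 <;> simp only [squareAbove, hkl, hx, hs] <;> linarith
end

section
/- Let z*, z̃* ∈ E⁺, let Q ∈ GP(z*) and Q̃ ∈ GP(z̃*), and suppose Q ∩ Q̃ ≠ ∅. Then z* = z̃*. (Equivalently, at the level of shadows: if J ∈ Gp(x*), J̃ ∈ Gp(x̃*) for x*, x̃* ∈ Ē⁺, with J ∩ J̃ ≠ ∅ and (1/2)|J| ≤ |J̃| ≤ 2|J|, then x* = x̃*.) -/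
theorem Sq.IsDyadic.side_pos {Q : Sq} (hQ : Q.IsDyadic) : 0 < Q.s := by
  rcases hQ with ⟨-, -, hs⟩ | ⟨k, -, -, -, -, -, -, -, -, hs⟩ <;> rw [hs] <;> positivity

theorem Sq.IsDyadic.side_le_two {Q : Sq} (hQ : Q.IsDyadic) : Q.s ≤ 2 := by
  rcases hQ with ⟨-, -, hs⟩ | ⟨k, -, -, -, -, -, -, -, -, hs⟩
  · exact hs.le
  · have : (2 : ℝ) ^ (-(k : ℤ)) ≤ 1 := zpow_le_one_of_nonpos₀ one_le_two (by omega)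
    linarith

/-- A dyadic square of side length less than `1` has a dyadic parent. -/
theorem Sq.IsDyadic.exists_parent {Q : Sq} (hQ : Q.IsDyadic) (hs : Q.s < 1) :
    ∃ P : Sq, P.IsDyadic ∧ P.s = 2 * Q.s ∧
      Q.x - Q.s ≤ P.x ∧ P.x ≤ Q.x ∧ Q.y - Q.s ≤ P.y ∧ P.y ≤ Q.y := by
  rcases hQ with ⟨-, -, hs'⟩ | ⟨k, i, j, hi, hi', hj, hj', hx, hy, hs'⟩
  · linarith
  rcases k with _ | k
  · norm_num [hs'] at hs
  have hpow : (2 : ℝ) ^ (-(k : ℤ)) = 2 * Q.s := by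
    rw [hs', ← zpow_one_add₀ two_ne_zero]
    congr 1
    push_cast
    ring
  have hpos : 0 < Q.s := by rw [hs']; positivity
  rw [← hs'] at hx hy
  rw [pow_succ] at hi hi' hj hj'
  have corner (n : ℤ) : (n : ℝ) * Q.s - Q.s ≤ ((n / 2 : ℤ) : ℝ) * (2 * Q.s) ∧
      ((n / 2 : ℤ) : ℝ) * (2 * Q.s) ≤ n * Q.s := by
    have h₁ : (n : ℝ) - 1 ≤ 2 * ((n / 2 : ℤ) : ℝ) := by
      exact_mod_cast (by omega : n - 1 ≤ 2 * (n / 2))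
    have h₂ : 2 * ((n / 2 : ℤ) : ℝ) ≤ n := by
      exact_mod_cast (by omega : 2 * (n / 2) ≤ n)
    constructor <;> nlinarith
  refine ⟨⟨(i / 2 : ℤ) * (2 : ℝ) ^ (-(k : ℤ)), (j / 2 : ℤ) * (2 : ℝ) ^ (-(k : ℤ)),
    (2 : ℝ) ^ (-(k : ℤ))⟩, Or.inr ⟨k, i / 2, j / 2, by omega, by omega, by omega, by omega,
    rfl, rfl, rfl⟩, hpow, ?_⟩
  dsimp only
  rw [hpow, hx, hy]
  exact ⟨(corner i).1, (corner i).2, (corner j).1, (corner j).2⟩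

/-- Touching Calderón–Zygmund squares have comparable side lengths. -/
theorem CZ.side_le_four_mul {Ebar : Finset ℝ} {Q Qt : Sq} (hQ : CZ Ebar Q) (hQt : CZ Ebar Qt)
    (hmeet : (Q.set ∩ Qt.set).Nonempty) : Q.s ≤ 4 * Qt.s := by
  by_contra! hlt
  have hQ2 := hQ.1.side_le_two
  have hpos := hQt.1.side_pos
  obtain ⟨P, hP, hPs, hx₁, hx₂, hy₁, hy₂⟩ := hQt.1.exists_parent (by linarith)
  obtain ⟨z, ⟨⟨hz₁, hz₂⟩, hz₃, hz₄⟩, ⟨hz₅, hz₆⟩, hz₇, hz₈⟩ := hmeet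
  have hdil : P.dilate 3 ⊆ Q.dilate 3 := by
    rintro w ⟨⟨hw₁, hw₂⟩, hw₃, hw₄⟩
    refine ⟨⟨?_, ?_⟩, ?_, ?_⟩ <;> linarith
  have hsub : Qt.set ⊆ P.set := by
    rintro w ⟨⟨hw₁, hw₂⟩, hw₃, hw₄⟩
    refine ⟨⟨?_, ?_⟩, ?_, ?_⟩ <;> linarith
  have heq := hQt.2.2 P hP (hQ.2.1.anti (Set.inter_subset_inter_right _ hdil)) hsub
  have hlow : (P.x, P.y) ∈ Qt.set := by
    rw [heq]
    refine ⟨⟨?_, ?_⟩, ?_, ?_⟩ <;> dsimp only <;> linarith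
  have hhigh : (P.x + P.s, P.y + P.s) ∈ Qt.set := by
    rw [heq]
    refine ⟨⟨?_, ?_⟩, ?_, ?_⟩ <;> dsimp only <;> linarith
  have h₁ : Qt.x ≤ P.x := hlow.1.1
  have h₂ : P.x + P.s ≤ Qt.x + Qt.s := hhigh.1.2
  linarith

/-- The base points of the groups of two touching Calderón–Zygmund squares are ordered one way. -/
theorem Gp.base_le_of_touching {Ebar : Finset ℝ} {u v : ℝ} {Q Qt : Sq} (hv : v ∈ EbarPlus Ebar)
    (hQ : CZ Ebar Q) (hQt : CZ Ebar Qt) (hu : Gp Ebar u (shadow Q))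
    (hvt : Gp Ebar v (shadow Qt)) (hmeet : (Q.set ∩ Qt.set).Nonempty) : v ≤ u := by
  by_contra! hlt
  have hside := hQ.side_le_four_mul hQt hmeet
  have hgap : v ≤ Qt.x - 20 * Qt.s := hvt.2.1
  obtain ⟨z, ⟨⟨-, hz₁⟩, -⟩, ⟨hz₂, -⟩, -⟩ := hmeet
  refine hu.2.2 v hv ⟨hlt, ?_⟩
  change v ≤ Q.x - 4 * Q.s
  linarith

/-- if `Q ∈ GP(z*)` and `Q̃ ∈ GP(z̃*)` (for `x*, x̃* ∈ Ē⁺`, where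
`GP(z*) = {Q ∈ CZ : π(Q) ∈ Gp(x*)}`) and `Q ∩ Q̃ ≠ ∅`, then `z* = z̃*`. -/
theorem groups_of_touching_squares_coincide (Ebar : Finset ℝ) (hE : EbarHyp Ebar)
    (xstar xtildestar : ℝ)
    (hx : xstar ∈ EbarPlus Ebar) (hxt : xtildestar ∈ EbarPlus Ebar)
    (Q Qt : Sq)
    (hQ : CZ Ebar Q ∧ Gp Ebar xstar (shadow Q))
    (hQt : CZ Ebar Qt ∧ Gp Ebar xtildestar (shadow Qt))
    (hmeet : (Q.set ∩ Qt.set).Nonempty) :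
    xstar = xtildestar := by
  exact le_antisymm
    (Gp.base_le_of_touching hx hQt.1 hQ.1 hQt.2 hQ.2 (by rwa [Set.inter_comm]))
    (Gp.base_le_of_touching hxt hQ.1 hQt.1 hQ.2 hQt.2 hmeet)
end

section
/- For every K ≥ 1 there is a constant C(K) depending only on K such that the number of easy Calderón–Zygmund squares is at most C(K)·N, where N = #E. Moreover, there is an absolute constant C such that the number of Calderón–Zygmund squares Q with 1.1Q ∩ E ≠ ∅ is at most C·N. -/
/-! ### Dyadic squares of side at most one -/

/-- The dyadic square `[i·2^{-m}, (i+1)·2^{-m}] × [j·2^{-m}, (j+1)·2^{-m}]`, for `t = (m, i, j)`. -/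
noncomputable def gridSq (t : ℕ × ℤ × ℤ) : Sq :=
  ⟨(t.2.1 : ℝ) * (2 : ℝ) ^ (-(t.1 : ℤ)), (t.2.2 : ℝ) * (2 : ℝ) ^ (-(t.1 : ℤ)),
    (2 : ℝ) ^ (-(t.1 : ℤ))⟩

lemma gridSq_s_pos (t : ℕ × ℤ × ℤ) : 0 < (gridSq t).s := by
  simp only [gridSq]; positivity

lemma EbarHyp.eset_inter_dilate_not_subsingleton {Ebar : Finset ℝ} (h : EbarHyp Ebar) {P : Sq}
    (hx : P.x = -1) (hy : P.y = -1) (hs : P.s = 2) :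
    ¬ (Eset Ebar ∩ P.dilate 3).Subsingleton := by
  intro hsub
  have hmem : ∀ a ∈ Ebar, |a| < 1 → ((a, 0) : ℝ × ℝ) ∈ Eset Ebar ∩ P.dilate 3 := by
    intro a ha ha'
    rw [abs_lt] at ha'
    refine ⟨⟨ha, rfl⟩, ?_⟩
    simp only [Sq.dilate, Set.mem_prod, Set.mem_Ioo, hx, hy, hs]
    refine ⟨⟨?_, ?_⟩, ?_, ?_⟩ <;> linarith
  have := hsub (hmem _ h.2.1 (by norm_num)) (hmem _ h.2.2.1 (by norm_num))
  rw [Prod.mk.injEq] at this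
  norm_num at this

lemma CZ.mem_range_gridSq {Ebar : Finset ℝ} (h : EbarHyp Ebar) {Q : Sq} (hQ : CZ Ebar Q) :
    ∃ t, gridSq t = Q := by
  obtain ⟨⟨hx, hy, hs⟩ | ⟨k, i, j, -, -, -, -, hx, hy, hs⟩, hsub, -⟩ := hQ
  · exact absurd hsub (h.eset_inter_dilate_not_subsingleton hx hy hs)
  · refine ⟨(k, i, j), ?_⟩
    cases Q
    simp_all [gridSq]

/-- The dyadic parent of a dyadic square of side at most one. -/
lemma exists_isDyadic_parent {Q : Sq} {k : ℕ} {i j : ℤ}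
    (hi : -(2 ^ k : ℤ) ≤ i) (hi' : i < 2 ^ k) (hj : -(2 ^ k : ℤ) ≤ j) (hj' : j < 2 ^ k)
    (hx : Q.x = (i : ℝ) * (2 : ℝ) ^ (-(k : ℤ))) (hy : Q.y = (j : ℝ) * (2 : ℝ) ^ (-(k : ℤ)))
    (hs : Q.s = (2 : ℝ) ^ (-(k : ℤ))) :
    ∃ P : Sq, P.IsDyadic ∧ P.s = 2 * Q.s ∧ (P.x = Q.x ∨ P.x = Q.x - Q.s) ∧
      (P.y = Q.y ∨ P.y = Q.y - Q.s) := by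
  rcases k with _ | k
  · have hi2 : i = -1 ∨ i = 0 := by simp at hi hi'; omega
    have hj2 : j = -1 ∨ j = 0 := by simp at hj hj'; omega
    refine ⟨⟨-1, -1, 2⟩, Or.inl ⟨rfl, rfl, rfl⟩, ?_, ?_, ?_⟩
    · simp [hs]
    · rcases hi2 with rfl | rfl <;> simp [hx, hs]
    · rcases hj2 with rfl | rfl <;> simp [hy, hs]
  · have hz : (2 : ℝ) ^ (-(k : ℤ)) = 2 * (2 : ℝ) ^ (-((k + 1 : ℕ) : ℤ)) := by
      rw [show -(k : ℤ) = 1 + -((k + 1 : ℕ) : ℤ) by push_cast; ring,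
        zpow_add₀ two_ne_zero, zpow_one]
    have hcoord : ∀ n : ℤ, ((n / 2 : ℤ) : ℝ) * (2 : ℝ) ^ (-(k : ℤ)) =
          n * (2 : ℝ) ^ (-((k + 1 : ℕ) : ℤ)) ∨
        ((n / 2 : ℤ) : ℝ) * (2 : ℝ) ^ (-(k : ℤ)) =
          n * (2 : ℝ) ^ (-((k + 1 : ℕ) : ℤ)) - (2 : ℝ) ^ (-((k + 1 : ℕ) : ℤ)) := by
      intro n
      rw [hz]
      rcases (by omega : n = 2 * (n / 2) ∨ n = 2 * (n / 2) + 1) with hn | hn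
      · left
        have : (n : ℝ) = 2 * ((n / 2 : ℤ) : ℝ) := by exact_mod_cast hn
        rw [this]; ring
      · right
        have : (n : ℝ) = 2 * ((n / 2 : ℤ) : ℝ) + 1 := by exact_mod_cast hn
        rw [this]; ring
    rw [pow_succ] at hi hi' hj hj'
    refine ⟨⟨(i / 2 : ℤ) * (2 : ℝ) ^ (-(k : ℤ)), (j / 2 : ℤ) * (2 : ℝ) ^ (-(k : ℤ)),
      (2 : ℝ) ^ (-(k : ℤ))⟩, Or.inr ⟨k, i / 2, j / 2, by omega, by omega, by omega, by omega,
        rfl, rfl, rfl⟩, ?_, ?_, ?_⟩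
    · simpa only [hs] using hz
    · simpa only [hx, hs] using hcoord i
    · simpa only [hy, hs] using hcoord j

/-- The dilate `7Q` of a Calderón–Zygmund square contains the open tripled parent of `Q`, and hence
two points of `E`. -/
lemma CZ.exists_pair {Ebar : Finset ℝ} (h : EbarHyp Ebar) {Q : Sq} (hQ : CZ Ebar Q) :
    ∃ a ∈ Ebar, ∃ b ∈ Ebar, a ≠ b ∧ ((a, 0) : ℝ × ℝ) ∈ Q.dilate 7 ∧
      ((b, 0) : ℝ × ℝ) ∈ Q.dilate 7 := by
  obtain ⟨⟨hx, hy, hs⟩ | ⟨k, i, j, hi, hi', hj, hj', hx, hy, hs⟩, hsub, hmax⟩ := hQ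
  · exact absurd hsub (h.eset_inter_dilate_not_subsingleton hx hy hs)
  obtain ⟨P, hP, hPs, hPx, hPy⟩ := exists_isDyadic_parent hi hi' hj hj' hx hy hs
  have hpos : 0 < Q.s := by rw [hs]; positivity
  have hsubset : Q.set ⊆ P.set := by
    rintro ⟨u, v⟩ ⟨⟨h1, h2⟩, h3, h4⟩
    refine ⟨⟨?_, ?_⟩, ?_, ?_⟩ <;> rcases hPx with hPx | hPx <;> rcases hPy with hPy | hPy <;>
      simp only [hPx, hPy, hPs] at * <;> linarith
  have hne : Q.set ≠ P.set := by
    intro heq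
    have h1 : ((P.x, P.y) : ℝ × ℝ) ∈ P.set := by
      refine ⟨⟨?_, ?_⟩, ?_, ?_⟩ <;> simp only <;> linarith
    have h2 : ((P.x + P.s, P.y) : ℝ × ℝ) ∈ P.set := by
      refine ⟨⟨?_, ?_⟩, ?_, ?_⟩ <;> simp only <;> linarith
    rw [← heq] at h1 h2
    have h3 := h1.1.1
    have h4 := h2.1.2
    simp only at h3 h4
    linarith
  have hPsub : ¬ (Eset Ebar ∩ P.dilate 3).Subsingleton := fun hP' => hne (hmax P hP hP' hsubset)
  rw [Set.not_subsingleton_iff] at hPsub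
  obtain ⟨⟨a, a'⟩, ⟨⟨ha, ha0⟩, haP⟩, ⟨b, b'⟩, ⟨⟨hb, hb0⟩, hbP⟩, hab⟩ := hPsub
  simp only at ha ha0 hb hb0
  subst ha0 hb0
  have hPQ : P.dilate 3 ⊆ Q.dilate 7 := by
    rintro ⟨u, v⟩ ⟨⟨h1, h2⟩, h3, h4⟩
    refine ⟨⟨?_, ?_⟩, ?_, ?_⟩ <;> rcases hPx with hPx | hPx <;> rcases hPy with hPy | hPy <;>
      simp only [hPx, hPy, hPs] at * <;> linarith
  exact ⟨a, ha, b, hb, fun hab' => hab (by rw [hab']), hPQ haP, hPQ hbP⟩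

lemma CZ.easyShadow_of_contact {Ebar : Finset ℝ} (h : EbarHyp Ebar) {Q : Sq} (hQ : CZ Ebar Q)
    (hE : (Eset Ebar ∩ Q.dilate 1.1).Nonempty) : EasyShadow Ebar 7 (shadow Q) := by
  obtain ⟨t, rfl⟩ := hQ.mem_range_gridSq h
  have hpos := gridSq_s_pos t
  set Q := gridSq t
  obtain ⟨⟨e, e'⟩, ⟨he, he0⟩, heQ⟩ := hE
  simp only at he he0
  subst he0
  obtain ⟨⟨h1, h2⟩, h3, h4⟩ := heQ
  obtain ⟨c, hc, hce, hc7⟩ : ∃ c ∈ Ebar, c ≠ e ∧ ((c, 0) : ℝ × ℝ) ∈ Q.dilate 7 := by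
    obtain ⟨a, ha, b, hb, hab, ha7, hb7⟩ := hQ.exists_pair h
    by_cases hae : a = e
    · exact ⟨b, hb, fun hbe => hab (hae.trans hbe.symm), hb7⟩
    · exact ⟨a, ha, hae, ha7⟩
  simp only at h1 h2 h3 h4
  have hc3 : ((c, 0) : ℝ × ℝ) ∉ Q.dilate 3 := by
    intro hc3
    have := hQ.2.1 ⟨⟨hc, rfl⟩, hc3⟩
      (show ((e, 0) : ℝ × ℝ) ∈ _ from
        ⟨⟨he, rfl⟩, ⟨by simp only; linarith, by simp only; linarith⟩,
          by simp only; linarith, by simp only; linarith⟩)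
    exact hce (congrArg Prod.fst this)
  have hdist : Q.s * 0.9 ≤ |e - c| := by
    by_contra! hlt
    rw [abs_lt] at hlt
    exact hc3 ⟨⟨by simp only; linarith, by simp only; linarith⟩,
      by simp only; linarith, by simp only; linarith⟩
  refine ⟨e, Finset.mem_insert_of_mem he, c, Finset.mem_insert_of_mem hc, ⟨?_, ?_⟩, hc7.1, ?_⟩ <;>
    simp only [shadow] <;> linarith

/-! ### Counting -/

lemma card_le_of_abs_sub_lt {s : Finset ℤ} {x K : ℝ} (hK : 0 ≤ K)
    (hs : ∀ i ∈ s, |(i : ℝ) - x| < K / 2) : (s.card : ℝ) ≤ K + 1 := by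
  have hsub : s ⊆ Finset.Icc ⌈x - K / 2⌉ ⌊x + K / 2⌋ := by
    intro i hi
    have := abs_lt.1 (hs i hi)
    rw [Finset.mem_Icc, Int.ceil_le, Int.le_floor]
    constructor <;> linarith
  have hcard : (s.card : ℝ) ≤ ((⌊x + K / 2⌋ + 1 - ⌈x - K / 2⌉).toNat : ℝ) := by
    exact_mod_cast (Finset.card_le_card hsub).trans_eq (Int.card_Icc _ _)
  refine hcard.trans ?_
  rw [← Int.cast_natCast, Int.toNat_eq_max, Int.cast_max, max_le_iff]
  push_cast
  exact ⟨by linarith [Int.floor_le (x + K / 2), Int.le_ceil (x - K / 2)], by linarith⟩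

lemma sum_mul_two_pow_le {A : Finset ℕ} {g K : ℝ} (hg : 0 ≤ g) (hK : 0 ≤ K)
    (hA : ∀ m ∈ A, g * 2 ^ m ≤ K) : ∑ m ∈ A, g * (2 : ℝ) ^ m ≤ 2 * K := by
  rcases A.eq_empty_or_nonempty with rfl | hne
  · simpa using hK
  have hmax := hA _ (A.max'_mem hne)
  calc ∑ m ∈ A, g * (2 : ℝ) ^ m ≤ ∑ m ∈ Finset.range (A.max' hne + 1), g * (2 : ℝ) ^ m := by
        refine Finset.sum_le_sum_of_subset_of_nonneg (fun m hm => ?_) fun _ _ _ => by positivity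
        exact Finset.mem_range.2 (Nat.lt_succ_of_le (A.le_max' m hm))
    _ = g * (2 ^ (A.max' hne + 1) - 1) := by
        rw [← Finset.mul_sum, geom_sum_eq (by norm_num)]; norm_num
    _ ≤ 2 * K := by rw [pow_succ]; nlinarith

/-- The shadow of the grid square `t` after dilation by `K` contains both `x` and `y`. -/
def Sees (K x y : ℝ) (t : ℕ × ℤ × ℤ) : Prop :=
  x ∈ (shadow (gridSq t)).dil K ∧ y ∈ (shadow (gridSq t)).dil K

lemma gridSq_s (t : ℕ × ℤ × ℤ) : (gridSq t).s = ((2 : ℝ) ^ t.1)⁻¹ := by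
  simp [gridSq]

lemma mem_dil_gridSq_iff {K x : ℝ} {t : ℕ × ℤ × ℤ} :
    x ∈ (shadow (gridSq t)).dil K ↔ |(t.2.1 : ℝ) - (x * 2 ^ t.1 - 1 / 2)| < K / 2 := by
  have h : (0 : ℝ) < 2 ^ t.1 := by positivity
  have h1 : (shadow (gridSq t)).dil K =
      Set.Ioo ((t.2.1 + 1 / 2 - K / 2) / 2 ^ t.1) ((t.2.1 + 1 / 2 + K / 2) / 2 ^ t.1) := by
    simp only [Iv.dil, shadow, gridSq, zpow_neg, zpow_natCast]
    congr 1 <;> field_simp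
  rw [h1, Set.mem_Ioo, div_lt_iff₀ h, lt_div_iff₀ h, abs_lt]
  constructor <;> rintro ⟨h2, h3⟩ <;> constructor <;> linarith

/-- The total weight `∑ (y - x) / |I|` over the grid squares whose dilated shadow `KI` contains
`x` and `y`. -/
lemma sum_weight_le {K x y : ℝ} (hK : 0 ≤ K) (hxy : x ≤ y) (F : Finset (ℕ × ℤ × ℤ))
    (hF : ∀ t ∈ F, Sees K x y t ∧ -3 ≤ t.2.2 ∧ t.2.2 ≤ 2) :
    ∑ t ∈ F, (y - x) * (2 : ℝ) ^ t.1 ≤ 12 * K * (K + 1) := by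
  have hfiber : ∀ m, ((F.filter fun t => t.1 = m).card : ℝ) ≤ 6 * (K + 1) := by
    intro m
    set A := (F.filter fun t => t.1 = m).image fun t => t.2.1
    have hA : (A.card : ℝ) ≤ K + 1 := by
      refine card_le_of_abs_sub_lt (x := x * 2 ^ m - 1 / 2) hK fun i hi => ?_
      obtain ⟨t, ht, rfl⟩ := Finset.mem_image.1 hi
      obtain ⟨htF, rfl⟩ := Finset.mem_filter.1 ht
      exact mem_dil_gridSq_iff.1 (hF t htF).1.1
    have hcard : (F.filter fun t => t.1 = m).card ≤ (A ×ˢ Finset.Icc (-3 : ℤ) 2).card := by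
      refine Finset.card_le_card_of_injOn Prod.snd (fun t ht => ?_) ?_
      · have htF := hF t (Finset.mem_filter.1 ht).1
        exact Finset.mem_product.2
          ⟨Finset.mem_image_of_mem _ ht, Finset.mem_Icc.2 htF.2⟩
      · intro t ht t' ht' heq
        exact Prod.ext ((Finset.mem_filter.1 ht).2.trans (Finset.mem_filter.1 ht').2.symm) heq
    rw [Finset.card_product, Int.card_Icc] at hcard
    have : ((F.filter fun t => t.1 = m).card : ℝ) ≤ A.card * 6 := by exact_mod_cast hcard
    linarith
  have hscale : ∀ m ∈ F.image Prod.fst, (y - x) * 2 ^ m ≤ K := by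
    intro m hm
    obtain ⟨t, ht, rfl⟩ := Finset.mem_image.1 hm
    have h1 := abs_lt.1 (mem_dil_gridSq_iff.1 (hF t ht).1.1)
    have h2 := abs_lt.1 (mem_dil_gridSq_iff.1 (hF t ht).1.2)
    linarith
  calc ∑ t ∈ F, (y - x) * (2 : ℝ) ^ t.1
      = ∑ m ∈ F.image Prod.fst, ∑ t ∈ F with t.1 = m, (y - x) * (2 : ℝ) ^ t.1 :=
        (Finset.sum_fiberwise_of_maps_to (fun t ht => Finset.mem_image_of_mem _ ht) _).symm
    _ ≤ ∑ m ∈ F.image Prod.fst, (6 * (K + 1)) * ((y - x) * (2 : ℝ) ^ m) := by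
        refine Finset.sum_le_sum fun m _ => ?_
        rw [Finset.sum_congr rfl (g := fun _ => (y - x) * (2 : ℝ) ^ m)
          fun t ht => by rw [(Finset.mem_filter.1 ht).2], Finset.sum_const, nsmul_eq_mul]
        exact mul_le_mul_of_nonneg_right (hfiber m)
          (mul_nonneg (sub_nonneg.2 hxy) (by positivity))
    _ ≤ (6 * (K + 1)) * (2 * K) := by
        rw [← Finset.mul_sum]
        exact mul_le_mul_of_nonneg_left (sum_mul_two_pow_le (sub_nonneg.2 hxy) hK hscale)
          (by positivity)
    _ = 12 * K * (K + 1) := by ring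

/-- Double counting of the weights `(f (k + 1) - f k) / |I|` over gaps and squares. -/
lemma card_le_of_sees {K : ℝ} (hK : 0 < K) {f : ℕ → ℝ} (hf : Monotone f) (n : ℕ)
    (F : Finset (ℕ × ℤ × ℤ))
    (hF : ∀ t ∈ F, (∃ a b, a ≤ b ∧ b ≤ n ∧ Sees K (f a) (f b) t ∧
      K⁻¹ * (gridSq t).s ≤ f b - f a) ∧ -3 ≤ t.2.2 ∧ t.2.2 ≤ 2) :
    (F.card : ℝ) ≤ 12 * K ^ 2 * (K + 1) * n := by
  classical
  have hlow : ∀ t ∈ F, K⁻¹ ≤ ∑ k ∈ Finset.range n with Sees K (f k) (f (k + 1)) t,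
      (f (k + 1) - f k) * (2 : ℝ) ^ t.1 := by
    intro t ht
    obtain ⟨⟨a, b, hab, hbn, ⟨hsa, hsb⟩, hdist⟩, -⟩ := hF t ht
    have hpow : (0 : ℝ) < 2 ^ t.1 := by positivity
    calc K⁻¹ ≤ (f b - f a) * 2 ^ t.1 := by
          rw [gridSq_s, ← div_eq_mul_inv, div_le_iff₀ hpow] at hdist
          exact hdist
      _ = ∑ k ∈ Finset.Ico a b, (f (k + 1) - f k) * (2 : ℝ) ^ t.1 := by
          rw [← Finset.sum_mul, Finset.sum_Ico_sub f hab]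
      _ ≤ _ := by
          refine Finset.sum_le_sum_of_subset_of_nonneg (fun k hk => ?_) fun k _ _ =>
            mul_nonneg (sub_nonneg.2 (hf k.le_succ)) hpow.le
          obtain ⟨h1, h2⟩ := Finset.mem_Ico.1 hk
          have hmem : ∀ l, a ≤ l → l ≤ b → f l ∈ (shadow (gridSq t)).dil K := fun l hl hl' =>
            ⟨hsa.1.trans_le (hf hl), (hf hl').trans_lt hsb.2⟩
          exact Finset.mem_filter.2 ⟨Finset.mem_range.2 (by omega),
            hmem k h1 h2.le, hmem (k + 1) (by omega) h2⟩
  have hmain : F.card * K⁻¹ ≤ n * (12 * K * (K + 1)) := calc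
    F.card * K⁻¹ = ∑ t ∈ F, K⁻¹ := by rw [Finset.sum_const, nsmul_eq_mul]
    _ ≤ ∑ t ∈ F, ∑ k ∈ Finset.range n with Sees K (f k) (f (k + 1)) t,
        (f (k + 1) - f k) * (2 : ℝ) ^ t.1 := Finset.sum_le_sum hlow
    _ = ∑ k ∈ Finset.range n, ∑ t ∈ F with Sees K (f k) (f (k + 1)) t,
        (f (k + 1) - f k) * (2 : ℝ) ^ t.1 := by
        simp only [Finset.sum_filter]
        exact Finset.sum_comm
    _ ≤ ∑ k ∈ Finset.range n, 12 * K * (K + 1) := by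
        refine Finset.sum_le_sum fun k _ => sum_weight_le hK.le (hf k.le_succ) _ fun t ht => ?_
        obtain ⟨htF, hts⟩ := Finset.mem_filter.1 ht
        exact ⟨hts, (hF t htF).2⟩
    _ = n * (12 * K * (K + 1)) := by rw [Finset.sum_const, Finset.card_range, nsmul_eq_mul]
  rw [← div_eq_mul_inv, div_le_iff₀ hK] at hmain
  linarith

/-- A nonempty finite set of reals is enumerated in increasing order. -/
lemma Finset.exists_monotone_enumeration (S : Finset ℝ) {n : ℕ} (hS : S.card = n + 1) :
    ∃ f : ℕ → ℝ, Monotone f ∧ ∀ x ∈ S, ∃ a ≤ n, f a = x := by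
  refine ⟨fun k => S.orderEmbOfFin hS ⟨min k n, by omega⟩, fun k l hkl => ?_, fun x hx => ?_⟩
  · exact (S.orderEmbOfFin hS).monotone (Fin.mk_le_mk.2 (min_le_min_right n hkl))
  · rw [← Finset.mem_coe, ← Finset.range_orderEmbOfFin S hS] at hx
    obtain ⟨⟨a, ha⟩, rfl⟩ := hx
    have ha' : a ≤ n := by omega
    exact ⟨a, ha', by simp only [min_eq_left ha']⟩

lemma Set.finite_and_ncard_le_of_forall_finset {α : Type*} {U : Set α} {c : ℕ}
    (h : ∀ F : Finset α, (F : Set α) ⊆ U → F.card ≤ c) : U.Finite ∧ U.ncard ≤ c := by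
  have hfin : U.Finite := by
    by_contra hinf
    obtain ⟨F, hFU, hF⟩ := Set.Infinite.exists_subset_card_eq hinf (c + 1)
    have := h F hFU
    omega
  refine ⟨hfin, ?_⟩
  rw [Set.ncard_eq_toFinset_card U hfin]
  exact h _ (by simp)

lemma CZ.gridSq_row_bounds {Ebar : Finset ℝ} (h : EbarHyp Ebar) {t : ℕ × ℤ × ℤ}
    (hQ : CZ Ebar (gridSq t)) : -3 ≤ t.2.2 ∧ t.2.2 ≤ 2 := by
  obtain ⟨a, -, -, -, -, ⟨-, h1, h2⟩, -⟩ := hQ.exists_pair h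
  have hpos := gridSq_s_pos t
  have hy : (gridSq t).y = t.2.2 * (gridSq t).s := rfl
  simp only [hy] at h1 h2
  have h3 : (-4 : ℝ) < t.2.2 := by by_contra! hle; nlinarith
  have h4 : (t.2.2 : ℝ) < 3 := by by_contra! hle; nlinarith
  have h3' : (-4 : ℤ) < t.2.2 := by exact_mod_cast h3
  have h4' : t.2.2 < (3 : ℤ) := by exact_mod_cast h4
  omega

/-- The number of easy Calderón–Zygmund squares is `O_K(N)`. -/
lemma easy_finite_and_ncard_le {K : ℝ} (hK : 0 < K) {Ebar : Finset ℝ} (h : EbarHyp Ebar) :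
    {Q : Sq | CZ Ebar Q ∧ EasyShadow Ebar K (shadow Q)}.Finite ∧
    {Q : Sq | CZ Ebar Q ∧ EasyShadow Ebar K (shadow Q)}.ncard ≤
      ⌈12 * K ^ 2 * (K + 1)⌉₊ * Ebar.card := by
  have hcard : (EbarPlus Ebar).card = Ebar.card + 1 := by
    refine Finset.card_insert_of_notMem fun hmem => ?_
    have := (h.2.2.2 _ hmem).1
    norm_num at this
  obtain ⟨f, hf, hfS⟩ := (EbarPlus Ebar).exists_monotone_enumeration hcard
  set U := {t | CZ Ebar (gridSq t) ∧ EasyShadow Ebar K (shadow (gridSq t))}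
  obtain ⟨hUfin, hU⟩ : U.Finite ∧ U.ncard ≤ ⌈12 * K ^ 2 * (K + 1)⌉₊ * Ebar.card := by
    refine Set.finite_and_ncard_le_of_forall_finset fun F hFU => ?_
    have hF := card_le_of_sees hK hf Ebar.card F fun t ht => by
      obtain ⟨hCZ, u, hu, v, hv, huI, hvI, huv⟩ := hFU ht
      refine ⟨?_, hCZ.gridSq_row_bounds h⟩
      obtain ⟨a, ha, rfl⟩ := hfS u hu
      obtain ⟨b, hb, rfl⟩ := hfS v hv
      rcases le_total a b with hab | hab
      · refine ⟨a, b, hab, hb, ⟨huI, hvI⟩, ?_⟩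
        rwa [abs_sub_comm, abs_of_nonneg (sub_nonneg.2 (hf hab))] at huv
      · refine ⟨b, a, hab, ha, ⟨hvI, huI⟩, ?_⟩
        rwa [abs_of_nonneg (sub_nonneg.2 (hf hab))] at huv
    have : (F.card : ℝ) ≤ (⌈12 * K ^ 2 * (K + 1)⌉₊ : ℝ) * Ebar.card :=
      hF.trans (mul_le_mul_of_nonneg_right (Nat.le_ceil _) (Nat.cast_nonneg _))
    exact_mod_cast this
  have hsub : {Q : Sq | CZ Ebar Q ∧ EasyShadow Ebar K (shadow Q)} ⊆ gridSq '' U := by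
    rintro Q ⟨hQ, hQ'⟩
    obtain ⟨t, rfl⟩ := hQ.mem_range_gridSq h
    exact ⟨t, ⟨hQ, hQ'⟩, rfl⟩
  have himg := hUfin.image gridSq
  exact ⟨himg.subset hsub,
    (Set.ncard_le_ncard hsub himg).trans ((Set.ncard_image_le hUfin).trans hU)⟩

/-- for every `K ≥ 1` there is a constant `C(K)` (depending only on `K`)
such that the number of easy CZ squares is at most `C(K)·N`, where `N = #E = #Ē`; and
there is an absolute constant `C` such that the number of CZ squares `Q` with
`1.1Q ∩ E ≠ ∅` is at most `C·N`. -/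
theorem count_easy_and_contact_squares :
    (∀ K : ℝ, 1 ≤ K → ∃ CK : ℕ, ∀ Ebar : Finset ℝ, EbarHyp Ebar →
      {Q : Sq | CZ Ebar Q ∧ EasyShadow Ebar K (shadow Q)}.Finite ∧
      {Q : Sq | CZ Ebar Q ∧ EasyShadow Ebar K (shadow Q)}.ncard ≤ CK * Ebar.card) ∧
    (∃ C : ℕ, ∀ Ebar : Finset ℝ, EbarHyp Ebar →
      {Q : Sq | CZ Ebar Q ∧ (Eset Ebar ∩ Q.dilate 1.1).Nonempty}.Finite ∧
      {Q : Sq | CZ Ebar Q ∧ (Eset Ebar ∩ Q.dilate 1.1).Nonempty}.ncard ≤ C * Ebar.card) := by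
  refine ⟨fun K hK => ⟨_, fun Ebar h => easy_finite_and_ncard_le (zero_lt_one.trans_le hK) h⟩,
    ⌈12 * (7 : ℝ) ^ 2 * (7 + 1)⌉₊, fun Ebar h => ?_⟩
  obtain ⟨hfin, hcard⟩ := easy_finite_and_ncard_le (by norm_num : (0 : ℝ) < 7) h
  have hsub : {Q : Sq | CZ Ebar Q ∧ (Eset Ebar ∩ Q.dilate 1.1).Nonempty} ⊆
      {Q : Sq | CZ Ebar Q ∧ EasyShadow Ebar 7 (shadow Q)} :=
    fun Q hQ => ⟨hQ.1, hQ.1.easyShadow_of_contact h hQ.2⟩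
  exact ⟨hfin.subset hsub, (Set.ncard_le_ncard hsub hfin).trans hcard⟩
end
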